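/- arXiv:0905.1091 — 4 statements merged into one kernel-verified Lean document; each statement's English description precedes it below -/
import Mathlib

section
/- For every α ∈ [0, 1/2] there exist a non-atomic standard Borel probability space (X, 𝓕, μ), an invertible measure-preserving transformation T of X which is α-rigid, and a nonzero f ∈ L²(μ) such that ⟨T̂^k f, f⟩ = 0 for every integer k ≠ 0 (so that the closed linear span of {T̂^k f : k ∈ ℤ} is a Lebesgue component in the spectrum of T). -/
open MeasureTheory Filter Topology
open scoped ENNReal InnerProductSpace

noncomputable section

/-- The Koopman operator `f ↦ f ∘ T` of a measure-preserving map, on real `L²`. -/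
def koopman {X : Type*} [MeasurableSpace X] {μ : Measure X} {T : X → X}
    (hT : MeasurePreserving T μ μ) : Lp ℝ 2 μ →L[ℝ] Lp ℝ 2 μ :=
  (Lp.compMeasurePreservingₗᵢ ℝ T hT).toContinuousLinearMap

/-- `T` is `α`-rigid on the sequence `k`: for every measurable set `A`,
`liminf_i μ(T^[k i] A ∩ A) ≥ α * μ A`. -/
def IsRigidSeqOn {X : Type*} [MeasurableSpace X] (μ : Measure X) (T : X ≃ᵐ X)
    (α : ℝ) (k : ℕ → ℕ) : Prop :=
  ∀ A : Set X, MeasurableSet A →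
    α * (μ A).toReal ≤ atTop.liminf fun i => (μ ((⇑T)^[k i] '' A ∩ A)).toReal

/-- `T` is `α`-rigid: `α` is the largest `β ∈ [0,1]` such that `T` is `β`-rigid on some
sequence of positive integers tending to infinity. -/
def IsAlphaRigid {X : Type*} [MeasurableSpace X] (μ : Measure X) (T : X ≃ᵐ X) (α : ℝ) : Prop :=
  IsGreatest {β : ℝ | β ∈ Set.Icc (0:ℝ) 1 ∧ ∃ k : ℕ → ℕ, (∀ i, 0 < k i) ∧
    Tendsto k atTop atTop ∧ IsRigidSeqOn μ T β k} α

namespace RandomToeplitz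

/-- The number of `j < k` such that `y + j` has `2`-adic order exactly `n`. -/
def orderCount (k : ℕ) (y : ℤ_[2]) (n : ℕ∞) : ℕ :=
  ((Finset.range k).filter fun j : ℕ => emultiplicity 2 (y + j) = n).card

/-- The `2`-adic orders occurring an odd number of times among `y, y + 1, …, y + (k - 1)`. -/
def oddOrders (k : ℕ) (y : ℤ_[2]) : Finset ℕ∞ :=
  ((Finset.range k).image fun j : ℕ => emultiplicity 2 (y + j)).filter
    fun n => Odd (orderCount k y n)

lemma mem_oddOrders {k : ℕ} {y : ℤ_[2]} {n : ℕ∞} :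
    n ∈ oddOrders k y ↔ Odd (orderCount k y n) := by
  simp only [oddOrders, Finset.mem_filter, and_iff_right_iff_imp]
  intro h
  obtain ⟨j, hj⟩ := Finset.card_pos.1 h.pos
  rw [Finset.mem_filter] at hj
  exact Finset.mem_image.2 ⟨j, hj⟩

lemma sum_emultiplicity_eq {M : Type*} [AddCommMonoid M] (hM : ∀ x : M, x + x = 0)
    (k : ℕ) (y : ℤ_[2]) (w : ℕ∞ → M) :
    ∑ j ∈ Finset.range k, w (emultiplicity 2 (y + (j : ℤ_[2]))) = ∑ n ∈ oddOrders k y, w n := by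
  have hsmul : ∀ (c : ℕ) (x : M), c • x = if Odd c then x else 0 := by
    intro c x
    rcases Nat.even_or_odd' c with ⟨d, rfl | rfl⟩
    · rw [if_neg (by simp), mul_nsmul', two_nsmul, ← nsmul_add, hM, nsmul_zero]
    · rw [if_pos (by simp), add_nsmul, mul_nsmul', two_nsmul, ← nsmul_add, hM, nsmul_zero, zero_add,
        one_nsmul]
  rw [Finset.sum_comp w, oddOrders, Finset.sum_filter]
  refine Finset.sum_congr rfl fun n _ => ?_
  rw [hsmul]
  rfl

lemma odd_card_oddOrders (k : ℕ) (y : ℤ_[2]) : Odd (oddOrders k y).card ↔ Odd k := by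
  rw [oddOrders, ← Finset.odd_sum_iff_odd_card_odd]
  have := Finset.card_eq_sum_card_image (fun j : ℕ => emultiplicity 2 (y + (j : ℤ_[2])))
    (Finset.range k)
  rw [Finset.card_range] at this
  exact (congrArg Odd this).to_iff.symm

lemma exists_dvd_add_iff (n : ℕ) (y : ℤ_[2]) :
    ∃ r : ℕ, r < 2 ^ n ∧ ∀ j : ℕ, (2 : ℤ_[2]) ^ n ∣ y + j ↔ j ≡ r [MOD 2 ^ n] := by
  have hdvd : ∀ x : ℤ_[2], (2 : ℤ_[2]) ^ n ∣ x ↔ PadicInt.toZModPow n x = 0 := by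
    intro x
    rw [← RingHom.mem_ker, PadicInt.ker_toZModPow, Ideal.mem_span_singleton]
    norm_num
  have : NeZero (2 ^ n) := ⟨by positivity⟩
  refine ⟨(PadicInt.toZModPow n (-y)).val, ZMod.val_lt _, fun j => ?_⟩
  rw [hdvd, ← ZMod.natCast_eq_natCast_iff, ZMod.natCast_zmod_val, map_add, map_neg, map_natCast,
    add_comm, add_eq_zero_iff_eq_neg]

open Classical in
lemma card_dvd_add (n q : ℕ) (y : ℤ_[2]) :
    ((Finset.range (2 ^ n * q)).filter fun j : ℕ => (2 : ℤ_[2]) ^ n ∣ y + j).card = q := by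
  obtain ⟨r, hr, h⟩ := exists_dvd_add_iff n y
  simp_rw [h]
  have := Nat.count_modEq_card_eq_ceil (2 ^ n * q) (r := 2 ^ n) (by positivity) r
  rw [Nat.count_eq_card_filter_range, Nat.mod_eq_of_lt hr] at this
  zify
  rw [this, Int.ceil_eq_iff]
  have h2 : (0 : ℚ) < 2 ^ n := by positivity
  have h3 : (r : ℚ) < 2 ^ n := by exact_mod_cast hr
  push_cast
  rw [lt_div_iff₀ h2, div_le_iff₀ h2]
  constructor <;> nlinarith [(Nat.cast_nonneg r : (0 : ℚ) ≤ r)]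

lemma emultiplicity_eq_iff (n : ℕ) (x : ℤ_[2]) :
    emultiplicity 2 x = n ↔ 2 ^ n ∣ x ∧ ¬ 2 ^ (n + 1) ∣ x :=
  emultiplicity_eq_coe

lemma orderCount_two_pow_mul (n m : ℕ) (y : ℤ_[2]) :
    orderCount (2 ^ (n + 1) * m) y n = m := by
  classical
  have h1 := card_dvd_add (n + 1) m y
  have h2 := card_dvd_add n (2 * m) y
  rw [← mul_assoc, ← pow_succ] at h2
  have h3 : ((Finset.range (2 ^ (n + 1) * m)).filter fun j : ℕ => (2 : ℤ_[2]) ^ n ∣ y + j) =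
      ((Finset.range (2 ^ (n + 1) * m)).filter fun j : ℕ => (2 : ℤ_[2]) ^ (n + 1) ∣ y + j) ∪
      ((Finset.range (2 ^ (n + 1) * m)).filter
        fun j : ℕ => emultiplicity 2 (y + (j : ℤ_[2])) = n) := by
    ext j
    simp only [Finset.mem_union, Finset.mem_filter, emultiplicity_eq_iff]
    have := fun h : (2 : ℤ_[2]) ^ (n + 1) ∣ y + j => (pow_dvd_pow (2 : ℤ_[2]) n.le_succ).trans h
    tauto
  have h4 : Disjoint
      ((Finset.range (2 ^ (n + 1) * m)).filter fun j : ℕ => (2 : ℤ_[2]) ^ (n + 1) ∣ y + j)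
      ((Finset.range (2 ^ (n + 1) * m)).filter
        fun j : ℕ => emultiplicity 2 (y + (j : ℤ_[2])) = n) := by
    rw [Finset.disjoint_filter]
    intro j _ h h'
    exact ((emultiplicity_eq_iff _ _).1 h').2 h
  rw [h3, Finset.card_union_of_disjoint h4, h1] at h2
  unfold orderCount
  omega

lemma oddOrders_nonempty {k : ℕ} (hk : 0 < k) (y : ℤ_[2]) : (oddOrders k y).Nonempty := by
  obtain ⟨a, m, hm, rfl⟩ := Nat.exists_eq_two_pow_mul_odd hk.ne'
  rcases a with _ | a
  · have := (odd_card_oddOrders (2 ^ 0 * m) y).2 (by simpa using hm)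
    exact Finset.card_pos.1 this.pos
  · exact ⟨a, mem_oddOrders.2 (by rwa [orderCount_two_pow_mul])⟩

lemma two_le_card_oddOrders {k : ℕ} (hk : 0 < k) (hk2 : Even k) (y : ℤ_[2]) :
    2 ≤ (oddOrders k y).card := by
  have h1 := Finset.card_pos.2 (oddOrders_nonempty hk y)
  have h2 : Even (oddOrders k y).card := by
    rwa [← Nat.not_odd_iff_even, odd_card_oddOrders, Nat.not_odd_iff_even]
  obtain ⟨c, hc⟩ := h2
  omega

lemma le_of_mem_oddOrders_two_pow {i : ℕ} {y : ℤ_[2]} {n : ℕ∞}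
    (hn : n ∈ oddOrders (2 ^ (i + 1)) y) : (i : ℕ∞) ≤ n := by
  by_contra! h
  obtain ⟨n, rfl⟩ := ENat.ne_top_iff_exists.1 h.ne_top
  rw [Nat.cast_lt] at h
  obtain ⟨d, rfl⟩ := Nat.exists_eq_add_of_lt h
  rw [mem_oddOrders, show 2 ^ (n + d + 1 + 1) = 2 ^ (n + 1) * (2 * 2 ^ d) by ring,
    orderCount_two_pow_mul] at hn
  exact (Nat.not_even_iff_odd.2 hn) (even_two_mul _)

lemma card_oddOrders_two_pow (i : ℕ) (y : ℤ_[2]) : (oddOrders (2 ^ (i + 1)) y).card = 2 := by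
  refine le_antisymm ?_ (two_le_card_oddOrders (by positivity) (by simp [Nat.even_pow]) y)
  obtain ⟨r, hr, h⟩ := exists_dvd_add_iff (i + 1) y
  refine (Finset.card_le_card (t := {(i : ℕ∞), emultiplicity 2 (y + (r : ℤ_[2]))})
    fun n hn => ?_).trans Finset.card_le_two
  rw [Finset.mem_insert, Finset.mem_singleton]
  refine (le_of_mem_oddOrders_two_pow hn).eq_or_lt'.imp id fun hlt => ?_
  obtain ⟨j, hj⟩ := Finset.card_pos.1 (mem_oddOrders.1 hn).pos
  obtain ⟨hjr, rfl⟩ := Finset.mem_filter.1 hj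
  have hd : (2 : ℤ_[2]) ^ (i + 1) ∣ y + j := by
    refine pow_dvd_of_le_emultiplicity ?_
    exact_mod_cast Order.add_one_le_of_lt hlt
  rw [(((h j).1 hd).eq_of_lt_of_lt (Finset.mem_range.1 hjr) hr : j = r)]

/-- The compact group `(ℤ/2)^ℕ`. -/
abbrev Fibre : Type := ℕ → ZMod 2

/-- The normalized Haar measure of `(ℤ/2)^ℕ`. -/
def fibreHaar : Measure Fibre := Measure.addHaarMeasure ⊤

instance : fibreHaar.IsAddHaarMeasure := by unfold fibreHaar; infer_instance

instance : IsProbabilityMeasure fibreHaar := ⟨by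
  simpa [fibreHaar] using
    Measure.addHaarMeasure_self (K₀ := (⊤ : TopologicalSpace.PositiveCompacts Fibre))⟩

instance : (𝓝[≠] (0 : Fibre)).NeBot := by
  have h : Tendsto (fun n : ℕ => (Pi.single n 1 : Fibre)) atTop (𝓝[≠] 0) := by
    refine tendsto_nhdsWithin_iff.2 ⟨tendsto_pi_nhds.2 fun j => ?_,
      Eventually.of_forall fun n => by simp⟩
    refine tendsto_const_nhds.congr' ?_
    filter_upwards [eventually_gt_atTop j] with n hn
    simp [hn.ne]
  exact h.neBot

lemma fibre_add_self (x : Fibre) : x + x = 0 := by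
  ext j
  exact CharTwo.add_self_eq_zero (x j)

/-- The subgroup of `(ℤ/2)^ℕ` of sequences vanishing at all indices below `M`. -/
def initialZero (M : ℕ) : AddSubgroup Fibre where
  carrier := {z | ∀ j < M, z j = 0}
  zero_mem' := by simp
  add_mem' := fun {a b} ha hb j hj => by simp [ha j hj, hb j hj]
  neg_mem' := fun {a} ha j hj => by simp [ha j hj]

lemma mem_initialZero {M : ℕ} {z : Fibre} : z ∈ initialZero M ↔ ∀ j < M, z j = 0 := Iff.rfl

lemma isOpen_initialZero (M : ℕ) : IsOpen (initialZero M : Set Fibre) := by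
  have : (initialZero M : Set Fibre) = ⋂ j ∈ Set.Iio M, (fun z : Fibre => z j) ⁻¹' {0} := by
    ext z; simp [mem_initialZero]
  rw [this]
  exact (Set.finite_Iio M).isOpen_biInter fun j _ =>
    (isOpen_discrete _).preimage (continuous_apply j)

lemma measurableSet_initialZero (M : ℕ) : MeasurableSet (initialZero M : Set Fibre) :=
  (isOpen_initialZero M).measurableSet

lemma fibreHaar_initialZero_pos (M : ℕ) : 0 < fibreHaar (initialZero M) :=
  (isOpen_initialZero M).measure_pos _ ⟨0, (initialZero M).zero_mem⟩

lemma tendsto_fibreHaar_initialZero :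
    Tendsto (fun M => fibreHaar (initialZero M)) atTop (𝓝 0) := by
  have h := tendsto_measure_iInter_atTop (μ := fibreHaar)
    (s := fun M => (initialZero M : Set Fibre))
    (fun M => (measurableSet_initialZero M).nullMeasurableSet)
    (fun M N hMN z hz j hj => hz j (hj.trans_le hMN)) ⟨0, measure_ne_top _ _⟩
  have h0 : (⋂ M, (initialZero M : Set Fibre)) = {0} := by
    ext z
    simp only [Set.mem_iInter, SetLike.mem_coe, mem_initialZero, Set.mem_singleton_iff]
    refine ⟨fun hz => funext fun j => hz (j + 1) j j.lt_succ_self, ?_⟩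
    rintro rfl
    simp
  rwa [h0, measure_singleton] at h

/-- The uniform probability measure on the two-element subgroup of `(ℤ/2)^ℕ` of sequences
vanishing at all positive indices. -/
def coin : Measure Fibre :=
  (2⁻¹ : ℝ≥0∞) • (Measure.dirac 0 + Measure.dirac (Pi.single 0 1))

instance : IsProbabilityMeasure coin := ⟨by
  simp [coin, ENNReal.inv_two_add_inv_two]⟩

/-- The mixture of `coin` and `fibreHaar` with weights `q` and `1 - q`. -/
def mix (q : unitInterval) : Measure Fibre :=
  ENNReal.ofReal q • coin + ENNReal.ofReal (1 - q) • fibreHaar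

lemma ofReal_add_ofReal_one_sub (q : unitInterval) :
    ENNReal.ofReal q + ENNReal.ofReal (1 - q) = 1 := by
  rw [← ENNReal.ofReal_add q.2.1 (sub_nonneg.2 q.2.2)]
  simp

instance (q : unitInterval) : IsProbabilityMeasure (mix q) := ⟨by
  simp only [mix, Measure.add_apply, Measure.smul_apply, measure_univ, smul_eq_mul, mul_one,
    ofReal_add_ofReal_one_sub]⟩

lemma map_add_left_coin : coin.map (Pi.single 0 1 + ·) = coin := by
  have hm : Measurable fun z : Fibre => Pi.single 0 1 + z := by fun_prop
  rw [coin, Measure.map_smul, Measure.map_add _ _ hm, Measure.map_dirac' hm, Measure.map_dirac' hm,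
    fibre_add_self, add_zero, add_comm]

lemma map_add_left_mix (q : unitInterval) : (mix q).map (Pi.single 0 1 + ·) = mix q := by
  have hm : Measurable fun z : Fibre => Pi.single 0 1 + z := by fun_prop
  rw [mix, Measure.map_add _ _ hm, Measure.map_smul, Measure.map_smul, map_add_left_coin,
    map_add_left_eq_self]

lemma coin_conv_coin : coin ∗ coin = coin := by
  conv_lhs =>
    enter [1]
    rw [coin]
  rw [Measure.conv_smul_left, Measure.add_conv, Measure.dirac_conv, Measure.dirac_conv,
    map_add_left_coin]
  simp only [zero_add, Measure.map_id']
  ext s hs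
  simp [← two_mul, ← mul_assoc, ENNReal.mul_inv_cancel]

lemma conv_fibreHaar (ν : Measure Fibre) [IsProbabilityMeasure ν] :
    ν ∗ fibreHaar = fibreHaar := by
  refine Measure.ext_of_lintegral _ fun f hf => ?_
  rw [Measure.lintegral_conv hf]
  simp_rw [lintegral_add_left_eq_self]
  simp

lemma mix_conv_mix (p q : unitInterval) : mix p ∗ mix q = mix (p * q) := by
  have h : ENNReal.ofReal p * ENNReal.ofReal (1 - q) + ENNReal.ofReal (1 - p) * ENNReal.ofReal q +
      ENNReal.ofReal (1 - p) * ENNReal.ofReal (1 - q) = ENNReal.ofReal (1 - p * q) := by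
    have hp := sub_nonneg.2 p.2.2
    have hq := sub_nonneg.2 q.2.2
    rw [← ENNReal.ofReal_mul p.2.1, ← ENNReal.ofReal_mul hp, ← ENNReal.ofReal_mul hp,
      ← ENNReal.ofReal_add (mul_nonneg p.2.1 hq) (mul_nonneg hp q.2.1),
      ← ENNReal.ofReal_add (add_nonneg (mul_nonneg p.2.1 hq) (mul_nonneg hp q.2.1))
        (mul_nonneg hp hq)]
    congr 1
    ring
  have h' : mix p ∗ mix q = ENNReal.ofReal p • (coin ∗ mix q) +
      ENNReal.ofReal (1 - p) • (fibreHaar ∗ mix q) := by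
    conv_lhs => enter [1]; rw [mix]
    rw [Measure.add_conv, Measure.conv_smul_left, Measure.conv_smul_left]
  have h'' : coin ∗ mix q = mix q := by
    rw [mix, Measure.conv_add, Measure.conv_smul_right, Measure.conv_smul_right, coin_conv_coin,
      conv_fibreHaar]
  rw [h', h'', Measure.conv_comm, conv_fibreHaar]
  simp only [mix, Set.Icc.coe_mul]
  rw [← h, ENNReal.ofReal_mul p.2.1, smul_add, smul_smul, smul_smul, add_assoc, ← add_smul]
  congr 2
  rw [add_assoc, ← mul_add, ofReal_add_ofReal_one_sub, mul_one]

lemma mix_zero_singleton (q : unitInterval) : mix q {0} = ENNReal.ofReal q / 2 := by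
  simp [mix, coin, div_eq_mul_inv]

lemma mix_initialZero_le (q : unitInterval) {M : ℕ} (hM : 0 < M) :
    mix q (initialZero M) ≤ ENNReal.ofReal q / 2 + fibreHaar (initialZero M) := by
  have h0 : (0 : Fibre) ∈ (initialZero M : Set Fibre) := (initialZero M).zero_mem
  have h1 : (Pi.single 0 1 : Fibre) ∉ (initialZero M : Set Fibre) := fun h => by
    simpa using h 0 hM
  have h2 : coin (initialZero M) = 2⁻¹ := by
    simp [coin, (measurableSet_initialZero M), h0, h1]
  rw [mix, Measure.add_apply, Measure.smul_apply, Measure.smul_apply, h2, smul_eq_mul, smul_eq_mul,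
    div_eq_mul_inv]
  gcongr
  exact mul_le_of_le_one_left' (ENNReal.ofReal_le_one.2 (by linarith [q.2.1]))

/-- The character of `(ℤ/2)^ℕ` attached to the coordinate `0`. -/
def sign (z : Fibre) : ℝ := if z 0 = 0 then 1 else -1

lemma measurable_sign : Measurable sign :=
  (measurable_of_countable fun a : ZMod 2 => if a = 0 then (1 : ℝ) else -1).comp
    (measurable_pi_apply 0)

lemma sign_add (x y : Fibre) : sign (x + y) = sign x * sign y := by
  have h : ∀ a b : ZMod 2, (if a + b = 0 then (1 : ℝ) else -1) =
      (if a = 0 then 1 else -1) * (if b = 0 then 1 else -1) := by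
    have hz : ∀ a : ZMod 2, a = 0 ∨ a = 1 := by decide
    intro a b
    rcases hz a with rfl | rfl <;> rcases hz b with rfl | rfl <;>
      simp [CharTwo.add_self_eq_zero (1 : ZMod 2)]
  exact h _ _

lemma sign_mul_self (x : Fibre) : sign x * sign x = 1 := by
  rw [← sign_add, fibre_add_self]
  simp [sign]

lemma norm_sign (x : Fibre) : ‖sign x‖ = 1 := by
  unfold sign; split_ifs <;> simp

lemma integral_sign_mix (q : unitInterval) : ∫ z, sign z ∂(mix q) = 0 := by
  have hm : Measurable fun z : Fibre => Pi.single 0 1 + z := by fun_prop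
  have h : ∫ z, sign z ∂(mix q) = - ∫ z, sign z ∂(mix q) := by
    conv_lhs => rw [← map_add_left_mix q]
    rw [integral_map hm.aemeasurable measurable_sign.aestronglyMeasurable, ← integral_neg]
    refine integral_congr_ae (.of_forall fun z => ?_)
    change sign (Pi.single 0 1 + z) = -sign z
    rw [sign_add, show sign (Pi.single 0 1) = -1 by simp [sign], neg_one_mul]
  linarith

/-- The law of a family of independent `mix p`-distributed variables indexed by `ℕ∞`. -/
def noise (p : unitInterval) : Measure (ℕ∞ → Fibre) := Measure.infinitePi fun _ => mix p

instance (p : unitInterval) : IsProbabilityMeasure (noise p) := by unfold noise; infer_instance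

lemma iIndepFun_noise (p : unitInterval) :
    ProbabilityTheory.iIndepFun (fun (n : ℕ∞) (ω : ℕ∞ → Fibre) => ω n) (noise p) :=
  ProbabilityTheory.iIndepFun_infinitePi (X := fun _ x => x) fun _ => measurable_id

lemma map_sum_noise (p : unitInterval) {D : Finset ℕ∞} (hD : D.Nonempty) :
    (noise p).map (fun ω => ∑ n ∈ D, ω n) = mix (p ^ D.card) := by
  induction hD using Finset.Nonempty.cons_induction with
  | singleton a => simpa [noise] using Measure.infinitePi_map_eval (fun _ : ℕ∞ => mix p) a
  | cons a s ha hs ih =>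
    have hind := (iIndepFun_noise p).indepFun_finsetSum_of_notMem
      (fun n => measurable_pi_apply n) ha
    have h := hind.map_add_eq_map_conv_map₀ (by fun_prop) (measurable_pi_apply a).aemeasurable
    have he : (fun ω : ℕ∞ → Fibre => ∑ n ∈ Finset.cons a s ha, ω n) =
        (∑ n ∈ s, fun ω : ℕ∞ → Fibre => ω n) + fun ω => ω a := by
      funext ω
      simp only [Finset.sum_cons, Pi.add_apply, Finset.sum_apply, add_comm]
    have hs' : (∑ n ∈ s, fun ω : ℕ∞ → Fibre => ω n) = fun ω => ∑ n ∈ s, ω n := by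
      ext ω; simp
    rw [he, h, hs', ih, Finset.card_cons, pow_succ, ← mix_conv_mix]
    congr 1
    exact Measure.infinitePi_map_eval (fun _ : ℕ∞ => mix p) a

instance : MeasurableSpace ℤ_[2] := borel _

instance : BorelSpace ℤ_[2] := ⟨rfl⟩

/-- The normalized Haar measure of the `2`-adic integers. -/
def baseHaar : Measure ℤ_[2] := Measure.addHaarMeasure ⊤

instance : baseHaar.IsAddHaarMeasure := by unfold baseHaar; infer_instance

instance : IsProbabilityMeasure baseHaar := ⟨by
  simpa [baseHaar] using
    Measure.addHaarMeasure_self (K₀ := (⊤ : TopologicalSpace.PositiveCompacts ℤ_[2]))⟩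

lemma two_pow_dvd_iff_norm_le (n : ℕ) (y : ℤ_[2]) :
    (2 : ℤ_[2]) ^ n ∣ y ↔ ‖y‖ ≤ (2 : ℝ) ^ (-n : ℤ) := by
  rw [← Ideal.mem_span_singleton]
  exact_mod_cast (PadicInt.norm_le_pow_iff_mem_span_pow y n).symm

lemma measurableSet_two_pow_dvd (n : ℕ) : MeasurableSet {y : ℤ_[2] | (2 : ℤ_[2]) ^ n ∣ y} := by
  simp_rw [two_pow_dvd_iff_norm_le]
  exact measurableSet_le measurable_norm measurable_const

lemma measurable_emultiplicity_two : Measurable fun y : ℤ_[2] => emultiplicity 2 y := by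
  have h : ∀ n : ℕ, MeasurableSet ((fun y : ℤ_[2] => emultiplicity 2 y) ⁻¹' {(n : ℕ∞)}) := by
    intro n
    have : (fun y : ℤ_[2] => emultiplicity 2 y) ⁻¹' {(n : ℕ∞)} =
        {y : ℤ_[2] | (2 : ℤ_[2]) ^ n ∣ y} \ {y : ℤ_[2] | (2 : ℤ_[2]) ^ (n + 1) ∣ y} := by
      ext y; exact emultiplicity_eq_iff n y
    rw [this]
    exact (measurableSet_two_pow_dvd n).diff (measurableSet_two_pow_dvd (n + 1))
  refine measurable_to_countable' fun n => ?_
  induction n with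
  | coe n => exact h n
  | top =>
    have : (fun y : ℤ_[2] => emultiplicity 2 y) ⁻¹' {⊤} =
        (⋃ n : ℕ, (fun y : ℤ_[2] => emultiplicity 2 y) ⁻¹' {(n : ℕ∞)})ᶜ := by
      ext y
      simp only [Set.mem_preimage, Set.mem_singleton_iff, Set.mem_compl_iff, Set.mem_iUnion,
        not_exists]
      rw [← not_iff_not, ← ne_eq, ENat.ne_top_iff_exists]
      push Not
      simp_rw [eq_comm]
    rw [this]
    exact (MeasurableSet.iUnion h).compl

/-- The phase space: a sequence of noise variables, a point of the odometer, a point of the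
fibre. -/
abbrev Phase : Type := (ℕ∞ → Fibre) × (ℤ_[2] × Fibre)

/-- The reference probability measure on the phase space. -/
def phaseMeasure (p : unitInterval) : Measure Phase := (noise p).prod (baseHaar.prod fibreHaar)

instance (p : unitInterval) : IsProbabilityMeasure (phaseMeasure p) := by
  unfold phaseMeasure; infer_instance

instance (p : unitInterval) : NullSingletonClass (phaseMeasure p) := by
  unfold phaseMeasure; infer_instance

lemma standardBorelSpace_phase : StandardBorelSpace Phase := inferInstance

lemma measurable_eval_emultiplicity :
    Measurable fun x : (ℕ∞ → Fibre) × ℤ_[2] => x.1 (emultiplicity 2 x.2) := by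
  have h : Measurable fun x : (ℕ∞ → Fibre) × ℕ∞ => x.1 x.2 :=
    measurable_from_prod_countable_left fun n => measurable_pi_apply n
  exact h.comp (measurable_fst.prodMk (measurable_emultiplicity_two.comp measurable_snd))

/-- The random Toeplitz extension of the odometer: `y` moves to `y + 1`, and the fibre coordinate
is translated by the noise variable indexed by the `2`-adic order of `y`. -/
def toeplitz : Phase ≃ᵐ Phase where
  toFun x := (x.1, x.2.1 + 1, x.2.2 + x.1 (emultiplicity 2 x.2.1))
  invFun x := (x.1, x.2.1 - 1, x.2.2 - x.1 (emultiplicity 2 (x.2.1 - 1)))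
  left_inv x := by simp
  right_inv x := by simp
  measurable_toFun := by
    have h : Measurable fun x : Phase => x.1 (emultiplicity 2 x.2.1) :=
      measurable_eval_emultiplicity.comp (by fun_prop : Measurable fun x : Phase => (x.1, x.2.1))
    exact measurable_fst.prodMk (by fun_prop)
  measurable_invFun := by
    have h : Measurable fun x : Phase => x.1 (emultiplicity 2 (x.2.1 - 1)) :=
      measurable_eval_emultiplicity.comp
        (by fun_prop : Measurable fun x : Phase => (x.1, x.2.1 - 1))
    exact measurable_fst.prodMk (by fun_prop)

lemma toeplitz_apply (x : Phase) :
    toeplitz x = (x.1, x.2.1 + 1, x.2.2 + x.1 (emultiplicity 2 x.2.1)) := rfl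

lemma measurePreserving_toeplitz (p : unitInterval) :
    MeasurePreserving toeplitz (phaseMeasure p) (phaseMeasure p) := by
  refine (MeasurePreserving.id (noise p)).skew_product
    (g := fun ω (v : ℤ_[2] × Fibre) => (v.1 + 1, v.2 + ω (emultiplicity 2 v.1))) ?_
    (.of_forall fun ω => ?_)
  · exact measurable_snd.comp toeplitz.measurable
  · refine ((measurePreserving_add_right baseHaar 1).skew_product
      (g := fun y z => z + ω (emultiplicity 2 y)) ?_ (.of_forall fun y => ?_)).map_eq
    · have h : Measurable fun y : ℤ_[2] => ω (emultiplicity 2 y) :=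
        (measurable_of_countable ω).comp measurable_emultiplicity_two
      exact measurable_snd.add (h.comp measurable_fst)
    · exact map_add_right_eq_self _ _

/-- The total translation of the fibre over `y` during `k` steps. -/
def cocycle (k : ℕ) (ω : ℕ∞ → Fibre) (y : ℤ_[2]) : Fibre :=
  ∑ j ∈ Finset.range k, ω (emultiplicity 2 (y + (j : ℤ_[2])))

lemma cocycle_eq_sum_oddOrders (k : ℕ) (ω : ℕ∞ → Fibre) (y : ℤ_[2]) :
    cocycle k ω y = ∑ n ∈ oddOrders k y, ω n :=
  sum_emultiplicity_eq fibre_add_self k y ω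

lemma measurable_cocycle (k : ℕ) : Measurable fun x : Phase => cocycle k x.1 x.2.1 := by
  refine Finset.measurable_fun_sum _ fun j _ => ?_
  exact measurable_eval_emultiplicity.comp
    (by fun_prop : Measurable fun x : Phase => (x.1, x.2.1 + (j : ℤ_[2])))

lemma toeplitz_iterate (k : ℕ) (x : Phase) :
    toeplitz^[k] x = (x.1, x.2.1 + k, x.2.2 + cocycle k x.1 x.2.1) := by
  induction k with
  | zero => simp [cocycle]
  | succ k ih =>
    rw [Function.iterate_succ_apply', ih, toeplitz_apply]
    simp [cocycle, Finset.sum_range_succ, add_assoc]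

lemma map_cocycle (p : unitInterval) {k : ℕ} (hk : 0 < k) (y : ℤ_[2]) :
    (noise p).map (fun ω => cocycle k ω y) = mix (p ^ (oddOrders k y).card) := by
  simp_rw [cocycle_eq_sum_oddOrders]
  exact map_sum_noise p (oddOrders_nonempty hk y)

lemma measurable_cocycle_left (k : ℕ) (y : ℤ_[2]) : Measurable fun ω => cocycle k ω y :=
  (measurable_cocycle k).comp (by fun_prop : Measurable fun ω => ((ω, y, 0) : Phase))

lemma integral_sign_cocycle (p : unitInterval) {k : ℕ} (hk : 0 < k) (y : ℤ_[2]) :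
    ∫ ω, sign (cocycle k ω y) ∂(noise p) = 0 := by
  rw [← integral_map (measurable_cocycle_left k y).aemeasurable
    measurable_sign.aestronglyMeasurable, map_cocycle p hk, integral_sign_mix]

lemma measure_image_iterate_inter (p : unitInterval) (k : ℕ) {A : Set Phase}
    (hA : MeasurableSet A) : phaseMeasure p (toeplitz^[k] '' A ∩ A) =
      phaseMeasure p (A ∩ toeplitz^[k] ⁻¹' A) := by
  have hk := (measurePreserving_toeplitz p).iterate k
  have hb : Function.Bijective toeplitz^[k] := toeplitz.bijective.iterate k
  have hm : MeasurableSet (toeplitz^[k] '' A) := by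
    have : toeplitz^[k] '' A = toeplitz.symm^[k] ⁻¹' A :=
      congrFun (Set.image_eq_preimage_of_inverse (f := toeplitz^[k]) (g := toeplitz.symm^[k])
        (Function.LeftInverse.iterate toeplitz.left_inv k)
        (Function.RightInverse.iterate toeplitz.right_inv k)) A
    rw [this]
    exact (toeplitz.symm.measurable.iterate k) hA
  rw [← hk.measure_preimage (hm.inter hA).nullMeasurableSet, Set.preimage_inter,
    hb.injective.preimage_image]

instance : (𝓝[≠] (0 : ℤ_[2])).NeBot := by
  have h : Tendsto (fun n : ℕ => (2 : ℤ_[2]) ^ n) atTop (𝓝[≠] 0) := by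
    refine tendsto_nhdsWithin_iff.2 ⟨tendsto_pow_atTop_nhds_zero_of_norm_lt_one ?_,
      .of_forall fun n => pow_ne_zero n two_ne_zero⟩
    exact PadicInt.norm_lt_one_iff_dvd (p := 2) _ |>.2 (by norm_num)
  exact h.neBot

lemma ae_top_notMem_oddOrders (k : ℕ) : ∀ᵐ y ∂baseHaar, ⊤ ∉ oddOrders k y := by
  have h : (Set.range fun j : ℕ => -(j : ℤ_[2])).Countable := Set.countable_range _
  filter_upwards [h.ae_notMem baseHaar] with y hy htop
  obtain ⟨j, hj⟩ := Finset.card_pos.1 (mem_oddOrders.1 htop).pos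
  have hj := (Finset.mem_filter.1 hj).2
  refine hy ⟨j, ?_⟩
  have : y + (j : ℤ_[2]) = 0 := by
    by_contra h0
    exact (finiteMultiplicity_iff_emultiplicity_ne_top.1
      (FiniteMultiplicity.of_prime_left (by exact_mod_cast PadicInt.prime_p (p := 2)) h0)) hj
  exact (eq_neg_of_add_eq_zero_left this).symm

/-- Two points of the phase space agree at level `n` if they have the same fibre coordinate, base
points congruent modulo `2 ^ n`, and the same noise variables except possibly those with a finite
index at least `n`. -/
def Agree (n : ℕ) (x x' : Phase) : Prop :=
  (∀ j : ℕ∞, (j < n ∨ j = ⊤) → x.1 j = x'.1 j) ∧ (2 : ℤ_[2]) ^ n ∣ x.2.1 - x'.2.1 ∧ x.2.2 = x'.2.2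

lemma Agree.mono {m n : ℕ} (h : m ≤ n) {x x' : Phase} (hx : Agree n x x') : Agree m x x' :=
  ⟨fun j hj => hx.1 j (hj.imp_left fun hj => hj.trans_le (by exact_mod_cast h)),
    (pow_dvd_pow 2 h).trans hx.2.1, hx.2.2⟩

/-- A cylinder of level `n` is a measurable set determined by the agreement relation. -/
def IsCylinder (n : ℕ) (A : Set Phase) : Prop :=
  MeasurableSet A ∧ ∀ x x', Agree n x x' → (x ∈ A ↔ x' ∈ A)

lemma IsCylinder.mono {m n : ℕ} (h : m ≤ n) {A : Set Phase} (hA : IsCylinder m A) :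
    IsCylinder n A :=
  ⟨hA.1, fun x x' hx => hA.2 x x' (hx.mono h)⟩

lemma isSetRing_cylinders : IsSetRing {A : Set Phase | ∃ n, IsCylinder n A} where
  empty_mem := ⟨0, .empty, fun _ _ _ => Iff.rfl⟩
  union_mem := by
    rintro s t ⟨m, hs⟩ ⟨n, ht⟩
    have hs := hs.mono (le_max_left m n)
    have ht := ht.mono (le_max_right m n)
    exact ⟨_, hs.1.union ht.1, fun x x' hx => or_congr (hs.2 x x' hx) (ht.2 x x' hx)⟩
  sdiff_mem := by
    rintro s t ⟨m, hs⟩ ⟨n, ht⟩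
    have hs := hs.mono (le_max_left m n)
    have ht := ht.mono (le_max_right m n)
    exact ⟨_, hs.1.diff ht.1, fun x x' hx =>
      and_congr (hs.2 x x' hx) (not_congr (ht.2 x x' hx))⟩

lemma eq_iUnion_of_isOpen {U : Set ℤ_[2]} (hU : IsOpen U) :
    U = ⋃ q ∈ {q : ℕ × ℕ | {y : ℤ_[2] | 2 ^ q.1 ∣ y - q.2} ⊆ U},
      {y : ℤ_[2] | 2 ^ q.1 ∣ y - (q.2 : ℤ_[2])} := by
  refine Set.Subset.antisymm (fun y hy => ?_) (Set.iUnion₂_subset fun q hq => hq)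
  obtain ⟨ε, hε, hb⟩ := Metric.isOpen_iff.1 hU y hy
  obtain ⟨n, hn⟩ := exists_pow_lt_of_lt_one hε (by norm_num : (2⁻¹ : ℝ) < 1)
  have h0 : (2 : ℤ_[2]) ^ n ∣ y - (y.appr n : ℕ) := by
    rw [← Ideal.mem_span_singleton]
    exact_mod_cast PadicInt.appr_spec n y
  refine Set.mem_biUnion (x := (n, y.appr n)) (fun w hw => hb ?_) h0
  have h1 : (2 : ℤ_[2]) ^ n ∣ w - y := by
    have := dvd_sub (Set.mem_ofPred.1 hw) h0
    rwa [sub_sub_sub_cancel_right] at this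
  rw [two_pow_dvd_iff_norm_le] at h1
  rw [Metric.mem_ball, dist_eq_norm]
  refine h1.trans_lt ?_
  rwa [zpow_neg, zpow_natCast, ← inv_pow]

lemma generateFrom_cylinders :
    (inferInstance : MeasurableSpace Phase) =
      MeasurableSpace.generateFrom {A : Set Phase | ∃ n, IsCylinder n A} := by
  refine le_antisymm ?_ (MeasurableSpace.generateFrom_le fun A ⟨n, hA⟩ => hA.1)
  have g1 : ∀ j : ℕ∞, Measurable fun x : Phase => x.1 j := by fun_prop
  have g2 : Measurable fun x : Phase => x.2.2 := by fun_prop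
  have g3 : ∀ a : ℕ, Measurable fun x : Phase => x.2.1 - (a : ℤ_[2]) := by fun_prop
  set m := MeasurableSpace.generateFrom {A : Set Phase | ∃ n, IsCylinder n A}
  have h1 : ∀ j : ℕ∞, Measurable[m] fun x : Phase => x.1 j := fun j s hs => by
    refine MeasurableSpace.measurableSet_generateFrom ?_
    induction j with
    | top =>
      exact ⟨0, g1 ⊤ hs,
        fun x x' hx => by simp [hx.1 ⊤ (.inr rfl)]⟩
    | coe j =>
      exact ⟨j + 1, g1 j hs,
        fun x x' hx => by simp [hx.1 j (.inl (by exact_mod_cast j.lt_succ_self))]⟩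
  have h2 : Measurable[m] fun x : Phase => x.2.2 := fun s hs =>
    MeasurableSpace.measurableSet_generateFrom
      ⟨0, g2 hs, fun x x' hx => by simp [hx.2.2]⟩
  have h3 : Measurable[m] fun x : Phase => x.2.1 := by
    refine @measurable_of_isOpen _ _ _ _ _ m _ fun U hU => ?_
    rw [eq_iUnion_of_isOpen hU, Set.preimage_iUnion₂]
    refine MeasurableSet.biUnion (Set.to_countable _) fun q _ =>
      MeasurableSpace.measurableSet_generateFrom ⟨q.1, ?_, fun x x' hx => ?_⟩
    · exact g3 q.2 (measurableSet_two_pow_dvd q.1)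
    · have := dvd_sub_comm.1 hx.2.1
      simp only [Set.mem_preimage, Set.mem_ofPred_eq]
      rw [← dvd_add_right this]
      simp
  have h4 : @Measurable Phase Phase m Prod.instMeasurableSpace id :=
    (measurable_pi_lambda _ h1).prodMk (h3.prodMk h2)
  exact fun s hs => h4 hs

lemma measure_cylinder_inter_cocycle (p : unitInterval) {n i : ℕ} (hni : n ≤ i) {A : Set Phase}
    (hA : IsCylinder n A) :
    phaseMeasure p (A ∩ {x | cocycle (2 ^ (i + 1)) x.1 x.2.1 = 0}) =
      ENNReal.ofReal (p ^ 2) / 2 * phaseMeasure p A := by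
  have hc : MeasurableSet {x : Phase | cocycle (2 ^ (i + 1)) x.1 x.2.1 = 0} :=
    measurable_cocycle _ (measurableSet_singleton 0)
  rw [phaseMeasure, Measure.prod_apply_symm (hA.1.inter hc), Measure.prod_apply_symm hA.1,
    ← lintegral_const_mul _ (measurable_measure_prodMk_right hA.1)]
  have hae : ∀ᵐ v ∂(baseHaar.prod fibreHaar), ⊤ ∉ oddOrders (2 ^ (i + 1)) v.1 :=
    Measure.quasiMeasurePreserving_fst.ae (ae_top_notMem_oddOrders _)
  refine lintegral_congr_ae ?_
  filter_upwards [hae] with v hv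
  set D := oddOrders (2 ^ (i + 1)) v.1
  classical
  let S : Finset ℕ∞ := insert ⊤ ((Finset.range n).image ((↑) : ℕ → ℕ∞))
  have hS : ∀ j : ℕ∞, (j < n ∨ j = ⊤) → j ∈ S := by
    rintro j (hj | rfl)
    · obtain ⟨l, rfl⟩ := ENat.ne_top_iff_exists.1 hj.ne_top
      exact Finset.mem_insert_of_mem (Finset.mem_image_of_mem _
        (Finset.mem_range.2 (by exact_mod_cast hj)))
    · exact Finset.mem_insert_self _ _
  have hdisj : Disjoint S D := by
    refine Finset.disjoint_left.2 fun j hj hjD => ?_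
    rcases Finset.mem_insert.1 hj with rfl | hj
    · exact hv hjD
    · obtain ⟨l, hl, rfl⟩ := Finset.mem_image.1 hj
      have h1 : (i : ℕ∞) ≤ l := le_of_mem_oddOrders_two_pow hjD
      have h2 : i ≤ l := by exact_mod_cast h1
      have := Finset.mem_range.1 hl
      omega
  let ext : (S → Fibre) → Phase := fun u => (fun j => if h : j ∈ S then u ⟨j, h⟩ else 0, v)
  have hext : Measurable ext := by
    refine Measurable.prodMk (measurable_pi_lambda _ fun j => ?_) measurable_const
    by_cases h : j ∈ S
    · simpa [h] using measurable_pi_apply _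
    · simp [h]
  have hind := (iIndepFun_noise p).indepFun_finset S D hdisj fun j => measurable_pi_apply j
  have hprod := hind.measure_inter_preimage_eq_mul (ext ⁻¹' A)
    ((fun u : D → Fibre => ∑ j, u j) ⁻¹' {0}) (hext hA.1)
    ((by fun_prop : Measurable fun u : D → Fibre => ∑ j, u j) (measurableSet_singleton 0))
  have hleft : (fun (ω : ℕ∞ → Fibre) (j : S) => ω j) ⁻¹' (ext ⁻¹' A) =
      (fun ω => (ω, v)) ⁻¹' A := by
    ext ω
    refine hA.2 _ _ ⟨fun j hj => ?_, by simp [ext], rfl⟩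
    simp [ext, hS j hj]
  have hright : (fun (ω : ℕ∞ → Fibre) (j : D) => ω j) ⁻¹'
      ((fun u : D → Fibre => ∑ j, u j) ⁻¹' {0}) =
      (fun ω => cocycle (2 ^ (i + 1)) ω v.1) ⁻¹' {0} := by
    ext ω
    simp only [Set.mem_preimage, cocycle_eq_sum_oddOrders, Set.mem_singleton_iff]
    rw [Finset.sum_coe_sort D ω]
  have hm : noise p ((fun ω => cocycle (2 ^ (i + 1)) ω v.1) ⁻¹' {0}) =
      ENNReal.ofReal (p ^ 2) / 2 := by
    rw [← Measure.map_apply (measurable_cocycle_left _ _) (measurableSet_singleton 0),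
      map_cocycle p (by positivity), card_oddOrders_two_pow, mix_zero_singleton]
    simp
  rw [hleft, hright, hm, mul_comm] at hprod
  exact hprod

lemma measure_cylinder_inter_preimage (p : unitInterval) {n i : ℕ} (hni : n ≤ i) {A : Set Phase}
    (hA : IsCylinder n A) :
    ENNReal.ofReal (p ^ 2) / 2 * phaseMeasure p A ≤
      phaseMeasure p (A ∩ toeplitz^[2 ^ (i + 1)] ⁻¹' A) := by
  rw [← measure_cylinder_inter_cocycle p hni hA]
  refine measure_mono fun x hx => ⟨hx.1, (hA.2 x _ ?_).1 hx.1⟩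
  rw [toeplitz_iterate]
  refine ⟨fun _ _ => rfl, ?_, ?_⟩
  · have : (2 : ℤ_[2]) ^ n ∣ 2 ^ (i + 1) := pow_dvd_pow 2 (by omega)
    simpa using this
  · simp [Set.mem_ofPred.1 hx.2]

lemma measure_inter_preimage_le_add (p : unitInterval) (k : ℕ) (A B : Set Phase) :
    phaseMeasure p (B ∩ toeplitz^[k] ⁻¹' B) ≤
      phaseMeasure p (A ∩ toeplitz^[k] ⁻¹' A) + 2 * phaseMeasure p (symmDiff B A) := by
  have h : B ∩ toeplitz^[k] ⁻¹' B ⊆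
      (A ∩ toeplitz^[k] ⁻¹' A) ∪ (symmDiff B A ∪ toeplitz^[k] ⁻¹' (symmDiff B A)) := by
    intro x hx
    by_cases h1 : x ∈ A <;> by_cases h2 : toeplitz^[k] x ∈ A
    · exact .inl ⟨h1, h2⟩
    · exact .inr (.inr (.inl ⟨hx.2, h2⟩))
    · exact .inr (.inl (.inl ⟨hx.1, h1⟩))
    · exact .inr (.inl (.inl ⟨hx.1, h1⟩))
  refine (measure_mono h).trans ((measure_union_le _ _).trans ?_)
  gcongr
  refine (measure_union_le _ _).trans ?_
  have hk := (measurePreserving_toeplitz p).iterate k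
  rw [two_mul]
  refine add_le_add le_rfl ?_
  exact (Measure.le_map_apply hk.measurable.aemeasurable _).trans_eq (by rw [hk.map_eq])

lemma isRigidSeqOn_toeplitz (p : unitInterval) :
    IsRigidSeqOn (phaseMeasure p) toeplitz ((p : ℝ) ^ 2 / 2) fun i => 2 ^ (i + 1) := by
  intro A hA
  refine le_of_forall_pos_le_add fun ε hε => ?_
  rw [← sub_le_iff_le_add]
  have hδ : 0 < ε / 3 := by positivity
  obtain ⟨B, ⟨n, hB⟩, hBA⟩ := exists_measure_symmDiff_lt_of_generateFrom_isSetRing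
    (μ := phaseMeasure p) isSetRing_cylinders
    ⟨{Set.univ}, Set.countable_singleton _, Set.singleton_subset_iff.2
      ⟨0, .univ, fun _ _ _ => Iff.rfl⟩, by simp⟩ generateFrom_cylinders hA
    (ENNReal.ofReal_pos.2 hδ)
  have hd : (phaseMeasure p (symmDiff B A)).toReal ≤ ε / 3 :=
    ENNReal.toReal_le_of_le_ofReal hδ.le hBA.le
  have hAB : (phaseMeasure p A).toReal ≤
      (phaseMeasure p B).toReal + (phaseMeasure p (symmDiff B A)).toReal := by
    rw [← ENNReal.toReal_add (measure_ne_top _ _) (measure_ne_top _ _)]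
    refine ENNReal.toReal_mono (by simp)
      ((measure_mono fun x hx => ?_).trans (measure_union_le _ _))
    by_cases h : x ∈ B
    · exact .inl h
    · exact .inr (.inr ⟨hx, h⟩)
  refine le_liminf_of_le (isCoboundedUnder_ge_of_le atTop (x := 1) fun i => ?_) ?_
  · exact ENNReal.toReal_le_of_le_ofReal zero_le_one (by simpa using prob_le_one)
  filter_upwards [eventually_ge_atTop n] with i hi
  have h1 := (measure_cylinder_inter_preimage p hi hB).trans
    (measure_inter_preimage_le_add p (2 ^ (i + 1)) A B)
  rw [← measure_image_iterate_inter p _ hA] at h1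
  have h2 := ENNReal.toReal_mono (by finiteness) h1
  rw [ENNReal.toReal_add (by finiteness) (by finiteness), ENNReal.toReal_mul, ENNReal.toReal_mul,
    ENNReal.toReal_div, ENNReal.toReal_ofReal (by positivity)] at h2
  simp only [ENNReal.toReal_ofNat] at h2
  have hp0 := p.2.1
  have hp : (p : ℝ) ^ 2 / 2 ≤ 1 := by nlinarith [p.2.2]
  have hp' : 0 ≤ (p : ℝ) ^ 2 / 2 := by positivity
  have h0 : 0 ≤ (phaseMeasure p (symmDiff B A)).toReal := ENNReal.toReal_nonneg
  nlinarith [mul_le_mul_of_nonneg_left hAB hp', mul_le_of_le_one_left h0 hp]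

/-- The points whose base coordinate is even and whose fibre coordinate vanishes at all indices
below `M`. -/
def evenInitialZero (M : ℕ) : Set Phase :=
  Set.univ ×ˢ ({y : ℤ_[2] | 2 ∣ y} ×ˢ (initialZero M : Set Fibre))

lemma measurableSet_two_dvd : MeasurableSet {y : ℤ_[2] | 2 ∣ y} := by
  simpa using measurableSet_two_pow_dvd 1

lemma measurableSet_evenInitialZero (M : ℕ) : MeasurableSet (evenInitialZero M) :=
  .prod .univ (measurableSet_two_dvd.prod (measurableSet_initialZero M))

lemma phaseMeasure_evenInitialZero_pos (p : unitInterval) (M : ℕ) :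
    0 < phaseMeasure p (evenInitialZero M) := by
  have h : IsOpen {y : ℤ_[2] | 2 ∣ y} := by
    have : {y : ℤ_[2] | 2 ∣ y} = {y | ‖y‖ < 1} := by
      ext y
      exact_mod_cast (PadicInt.norm_lt_one_iff_dvd (p := 2) y).symm
    rw [this]
    exact isOpen_lt continuous_norm continuous_const
  have h0 := h.measure_pos baseHaar ⟨0, dvd_zero 2⟩
  rw [evenInitialZero, phaseMeasure, Measure.prod_prod, Measure.prod_prod, measure_univ, one_mul]
  exact ENNReal.mul_pos h0.ne' (fibreHaar_initialZero_pos M).ne'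

lemma measure_evenInitialZero_inter_preimage_le (p : unitInterval) {k M : ℕ} (hk : 0 < k)
    (hM : 0 < M) : phaseMeasure p (evenInitialZero M ∩ toeplitz^[k] ⁻¹' evenInitialZero M) ≤
      (ENNReal.ofReal (p ^ 2) / 2 + fibreHaar (initialZero M)) *
        phaseMeasure p (evenInitialZero M) := by
  have hA := measurableSet_evenInitialZero M
  have hm : MeasurableSet (evenInitialZero M ∩ toeplitz^[k] ⁻¹' evenInitialZero M) :=
    hA.inter ((toeplitz.measurable.iterate k) hA)
  rw [phaseMeasure, Measure.prod_apply_symm hm, Measure.prod_apply_symm hA,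
    ← lintegral_const_mul _ (measurable_measure_prodMk_right hA)]
  refine lintegral_mono fun v => ?_
  by_cases hv : (2 : ℤ_[2]) ∣ v.1 ∧ v.2 ∈ initialZero M
  swap
  · refine (measure_mono_null (fun ω hω => ?_) measure_empty).trans_le zero_le
    exact hv hω.1.2
  have huniv : (fun ω => (ω, v)) ⁻¹' evenInitialZero M = Set.univ :=
    Set.eq_univ_of_forall fun ω => ⟨trivial, hv⟩
  rw [huniv, measure_univ, mul_one]
  have hsub : (fun ω => (ω, v)) ⁻¹' (evenInitialZero M ∩ toeplitz^[k] ⁻¹' evenInitialZero M) ⊆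
      {ω | Even k ∧ cocycle k ω v.1 ∈ initialZero M} := by
    rintro ω ⟨-, hω⟩
    rw [Set.mem_preimage, toeplitz_iterate] at hω
    have h1 : (2 : ℤ_[2]) ∣ v.1 + k := hω.2.1
    have h2 : v.2 + cocycle k ω v.1 ∈ initialZero M := hω.2.2
    refine ⟨?_, ((initialZero M).add_mem_cancel_left hv.2).1 h2⟩
    obtain ⟨r, -, hr⟩ := exists_dvd_add_iff 1 v.1
    simp only [pow_one] at hr
    have h0 := (hr 0).1 (by simpa using hv.1)
    exact even_iff_two_dvd.2 ((Nat.modEq_zero_iff_dvd).1 (((hr k).1 h1).trans h0.symm))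
  refine (measure_mono hsub).trans ?_
  by_cases hek : Even k
  swap
  · simp [hek]
  simp only [hek, true_and]
  have := Measure.map_apply (μ := noise p) (measurable_cocycle_left k v.1)
    (measurableSet_initialZero M)
  refine this.symm.trans_le ?_
  rw [map_cocycle p hk]
  refine (mix_initialZero_le _ hM).trans ?_
  gcongr
  exact_mod_cast pow_le_pow_of_le_one p.2.1 p.2.2 (two_le_card_oddOrders hk hek v.1)

lemma le_of_isRigidSeqOn_toeplitz (p : unitInterval) {β : ℝ} {k : ℕ → ℕ} (hk : ∀ i, 0 < k i)
    (h : IsRigidSeqOn (phaseMeasure p) toeplitz β k) : β ≤ (p : ℝ) ^ 2 / 2 := by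
  have hM : ∀ M : ℕ, 0 < M → β ≤ (p : ℝ) ^ 2 / 2 + (fibreHaar (initialZero M)).toReal := by
    intro M hM
    have hA := measurableSet_evenInitialZero M
    have hpos : 0 < (phaseMeasure p (evenInitialZero M)).toReal :=
      ENNReal.toReal_pos (phaseMeasure_evenInitialZero_pos p M).ne' (measure_ne_top _ _)
    refine le_of_mul_le_mul_right ((h _ hA).trans ?_) hpos
    refine liminf_le_of_frequently_le (Frequently.of_forall fun i => ?_)
      (isBoundedUnder_of ⟨0, fun i => ENNReal.toReal_nonneg⟩)
    rw [measure_image_iterate_inter p _ hA]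
    have h1 := ENNReal.toReal_mono (by finiteness)
      (measure_evenInitialZero_inter_preimage_le p (hk i) hM)
    rwa [ENNReal.toReal_mul, ENNReal.toReal_add (by finiteness) (by finiteness),
      ENNReal.toReal_div, ENNReal.toReal_ofReal (by positivity), ENNReal.toReal_ofNat] at h1
  have ht : Tendsto (fun M => (p : ℝ) ^ 2 / 2 + (fibreHaar (initialZero M)).toReal) atTop
      (𝓝 ((p : ℝ) ^ 2 / 2 + 0)) :=
    ((ENNReal.tendsto_toReal ENNReal.zero_ne_top).comp tendsto_fibreHaar_initialZero).const_add _
  rw [add_zero] at ht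
  exact ge_of_tendsto ht ((eventually_gt_atTop 0).mono hM)

lemma isAlphaRigid_toeplitz (p : unitInterval) :
    IsAlphaRigid (phaseMeasure p) toeplitz ((p : ℝ) ^ 2 / 2) := by
  refine ⟨⟨⟨by positivity, by nlinarith [p.2.1, p.2.2]⟩, fun i => 2 ^ (i + 1),
    fun i => by positivity, ?_, isRigidSeqOn_toeplitz p⟩, ?_⟩
  · exact (tendsto_pow_atTop_atTop_of_one_lt one_lt_two).comp (tendsto_add_atTop_nat 1)
  · rintro β ⟨-, k, hk, -, h⟩
    exact le_of_isRigidSeqOn_toeplitz p hk h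

/-- The sign of the fibre coordinate. -/
def fibreSign (x : Phase) : ℝ := sign x.2.2

lemma measurable_fibreSign : Measurable fibreSign :=
  measurable_sign.comp (measurable_snd.comp measurable_snd)

lemma memLp_fibreSign (p : unitInterval) : MemLp fibreSign 2 (phaseMeasure p) :=
  .of_bound measurable_fibreSign.aestronglyMeasurable 1
    (.of_forall fun x => (norm_sign x.2.2).le)

lemma integral_fibreSign_mul (p : unitInterval) {k : ℕ} (hk : 0 < k) :
    ∫ x, fibreSign (toeplitz^[k] x) * fibreSign x ∂(phaseMeasure p) = 0 := by
  have h : ∀ x, fibreSign (toeplitz^[k] x) * fibreSign x = sign (cocycle k x.1 x.2.1) := by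
    intro x
    rw [toeplitz_iterate, fibreSign, fibreSign, sign_add, mul_right_comm, sign_mul_self, one_mul]
  simp_rw [h]
  have hint : Integrable (fun x : Phase => sign (cocycle k x.1 x.2.1)) (phaseMeasure p) :=
    .of_bound (measurable_sign.comp (measurable_cocycle k)).aestronglyMeasurable 1
      (.of_forall fun x => (norm_sign _).le)
  rw [phaseMeasure] at hint ⊢
  rw [integral_prod_symm _ hint]
  simp [integral_sign_cocycle p hk]

end RandomToeplitz

/-- The powers of the Koopman operator act by composition with the iterates. -/
lemma koopman_pow_toLp {X : Type*} [MeasurableSpace X] {μ : Measure X} {T : X → X}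
    (hT : MeasurePreserving T μ μ) {g : X → ℝ} (hg : MemLp g 2 μ) (k : ℕ) :
    (koopman hT ^ k) (hg.toLp g) =
      (hg.comp_measurePreserving (hT.iterate k)).toLp (g ∘ T^[k]) := by
  induction k with
  | zero => rfl
  | succ k ih =>
    rw [pow_succ', mul_apply_eq_comp, ih]
    exact Lp.toLp_compMeasurePreserving _ hT

lemma inner_koopman_pow_toLp {X : Type*} [MeasurableSpace X] {μ : Measure X} {T : X → X}
    (hT : MeasurePreserving T μ μ) {g : X → ℝ} (hg : MemLp g 2 μ) (k : ℕ) :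
    ⟪(koopman hT ^ k) (hg.toLp g), hg.toLp g⟫_ℝ = ∫ x, g (T^[k] x) * g x ∂μ := by
  rw [koopman_pow_toLp, L2.inner_def]
  refine integral_congr_ae ?_
  filter_upwards [hg.coeFn_toLp, (hg.comp_measurePreserving (hT.iterate k)).coeFn_toLp]
    with x h1 h2
  rw [h1, h2, real_inner_eq_re_inner, RCLike.inner_apply]
  simp [mul_comm]

lemma integral_iterate_symm_mul {X : Type*} [MeasurableSpace X] {μ : Measure X} {T : X ≃ᵐ X}
    (hT : MeasurePreserving T μ μ) (g : X → ℝ) (k : ℕ) :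
    ∫ x, g (T.symm^[k] x) * g x ∂μ = ∫ x, g (T^[k] x) * g x ∂μ := by
  have hk : MeasurableEmbedding T^[k] := by
    induction k with
    | zero => exact .id
    | succ k ih => exact ih.comp T.measurableEmbedding
  rw [← (hT.iterate k).integral_comp hk]
  refine integral_congr_ae (.of_forall fun x => ?_)
  simp only
  rw [mul_comm, show T.symm^[k] (T^[k] x) = x from Function.LeftInverse.iterate T.left_inv k x]

open RandomToeplitz

/-- For every `α ∈ [0, 1/2]` there is a non-atomic standard Borel probability space and an
`α`-rigid invertible measure-preserving transformation `T` of it, together with a nonzero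
`f ∈ L²` whose orbit under the Koopman operator is orthogonal (`⟨T̂^k f, f⟩ = 0` for every
integer `k ≠ 0`, positive powers of `T̂` and of the Koopman operator of `T⁻¹`); hence the
closed span of the orbit is a Lebesgue component in the spectrum of `T`. -/
theorem exists_alphaRigid_with_lebesgue_component (α : ℝ) (hα : α ∈ Set.Icc (0 : ℝ) (1 / 2)) :
    ∃ (X : Type) (_ : MeasurableSpace X) (μ : Measure X) (T : X ≃ᵐ X)
      (hT : MeasurePreserving T μ μ),
      StandardBorelSpace X ∧ IsProbabilityMeasure μ ∧ NoAtoms μ ∧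
      IsAlphaRigid μ T α ∧
      ∃ f : Lp ℝ 2 μ, f ≠ 0 ∧ ∀ k : ℕ, 0 < k →
        ⟪(koopman hT ^ k) f, f⟫_ℝ = 0 ∧ ⟪(koopman hT.symm ^ k) f, f⟫_ℝ = 0 := by
  have h2 : 0 ≤ 2 * α := by linarith [hα.1]
  let p : unitInterval := ⟨√(2 * α), Real.sqrt_nonneg _, Real.sqrt_le_one.2 (by linarith [hα.2])⟩
  have hp : (p : ℝ) ^ 2 / 2 = α := by
    simp only [p, Real.sq_sqrt h2]
    ring
  refine ⟨Phase, inferInstance, phaseMeasure p, toeplitz, measurePreserving_toeplitz p,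
    standardBorelSpace_phase, inferInstance,
    (inferInstance : NullSingletonClass (phaseMeasure p)), hp ▸ isAlphaRigid_toeplitz p,
    (memLp_fibreSign p).toLp fibreSign, fun h0 => ?_, fun k hk => ⟨?_, ?_⟩⟩
  · have h1 := (memLp_fibreSign p).coeFn_toLp
    rw [h0] at h1
    obtain ⟨x, hx1, hx2⟩ := (h1.and (Lp.coeFn_zero ℝ 2 (phaseMeasure p))).exists
    have h3 := norm_sign x.2.2
    rw [hx2] at hx1
    rw [show sign x.2.2 = 0 from hx1.symm, norm_zero] at h3
    exact zero_ne_one h3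
  · rw [inner_koopman_pow_toLp, integral_fibreSign_mul p hk]
  · rw [inner_koopman_pow_toLp, integral_iterate_symm_mul (measurePreserving_toeplitz p),
      integral_fibreSign_mul p hk]
end
end

section
/- Let (X, 𝓕, μ) be a probability space, α ≥ 0, and let Q be a bounded positivity-preserving operator on L²(μ) such that ⟨Qg, g⟩ ≥ α·⟨g, g⟩ for every g ∈ L²(μ) with g ≥ 0 a.e. Then the operator Q' = Q − α·E (E the identity operator) is also positivity-preserving: for every f ∈ L²(μ) with f ≥ 0 a.e., Qf ≥ α·f a.e. -/
open MeasureTheory Filter Topology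
open scoped ENNReal InnerProductSpace

noncomputable section

/-- If `Q` is positivity-preserving and `⟨Qg, g⟩ ≥ α⟨g, g⟩` for all nonnegative `g`, then
`Q - α·E` is positivity-preserving: `Qf ≥ α·f` a.e. for every nonnegative `f`. -/
theorem sub_smul_id_posPreserving {X : Type*} [MeasurableSpace X]
    (μ : Measure X) [IsProbabilityMeasure μ]
    (α : ℝ) (hα : 0 ≤ α) (Q : Lp ℝ 2 μ →L[ℝ] Lp ℝ 2 μ)
    (hQpos : ∀ f : Lp ℝ 2 μ, 0 ≤ᵐ[μ] ⇑f → 0 ≤ᵐ[μ] ⇑(Q f))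
    (hQα : ∀ g : Lp ℝ 2 μ, 0 ≤ᵐ[μ] ⇑g → α * ⟪g, g⟫_ℝ ≤ ⟪Q g, g⟫_ℝ) :
    ∀ f : Lp ℝ 2 μ, 0 ≤ᵐ[μ] ⇑f → (fun x => α * f x) ≤ᵐ[μ] ⇑(Q f) := by
  intro f hf
  have hB : MeasurableSet {x | Q f x < α * f x} :=
    measurableSet_lt (Lp.stronglyMeasurable _).measurable
      ((Lp.stronglyMeasurable f).measurable.const_mul α)
  set B := {x | Q f x < α * f x}
  have hmem : MemLp (B.indicator f) 2 μ := (Lp.memLp f).indicator hB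
  set g : Lp ℝ 2 μ := hmem.toLp _
  have hg : ⇑g =ᵐ[μ] B.indicator f := hmem.coeFn_toLp
  have hg0 : 0 ≤ᵐ[μ] ⇑g := by
    filter_upwards [hg, hf] with x hx hfx
    rw [hx]
    exact Set.indicator_apply_nonneg fun _ => hfx
  have hfg : 0 ≤ᵐ[μ] ⇑(f - g) := by
    filter_upwards [hg, hf, Lp.coeFn_sub f g] with x hx hfx hsub
    rw [hsub, Pi.sub_apply, hx]
    by_cases hxB : x ∈ B
    · simp [hxB]
    · simpa [hxB] using hfx
  have hQg : ⇑(Q g) ≤ᵐ[μ] ⇑(Q f) := by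
    have h := hQpos _ hfg
    rw [map_sub] at h
    filter_upwards [h, Lp.coeFn_sub (Q f) (Q g)] with x hx hsub
    rw [hsub] at hx
    simpa using hx
  have hle : ⟪α • g - Q g, g⟫_ℝ ≤ 0 := by
    rw [inner_sub_left, real_inner_smul_left]
    linarith [hQα g hg0]
  -- Where `Q f < α f`, the integrand of this inner product is positive; elsewhere it vanishes.
  have key : ∀ᵐ x ∂μ, 0 ≤ ⟪(α • g - Q g) x, g x⟫_ℝ ∧
      (x ∈ B → 0 < ⟪(α • g - Q g) x, g x⟫_ℝ) := by
    filter_upwards [hg, hf, hQg, hQpos f hf, Lp.coeFn_sub (α • g) (Q g), Lp.coeFn_smul α g]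
      with x hx hfx hQgx hQfx hsub hsmul
    have hval : ⟪(α • g - Q g) x, g x⟫_ℝ = (α * g x - Q g x) * g x := by
      rw [hsub, Pi.sub_apply, hsmul, Pi.smul_apply, smul_eq_mul]
      simp [mul_comm]
    rw [hval, hx]
    by_cases hxB : x ∈ B
    · rw [Set.indicator_of_mem hxB]
      have hlt : Q f x < α * f x := hxB
      have hQf0 : 0 ≤ Q f x := hQfx
      have hf0 : 0 < f x := pos_of_mul_pos_right (hQf0.trans_lt hlt) hα
      have hpos : 0 < (α * f x - Q g x) * f x := mul_pos (by linarith) hf0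
      exact ⟨hpos.le, fun _ => hpos⟩
    · simp [hxB]
  have hnonneg : 0 ≤ᵐ[μ] fun x => ⟪(α • g - Q g) x, g x⟫_ℝ := key.mono fun _ h => h.1
  rw [L2.inner_def] at hle
  have hzero := (integral_eq_zero_iff_of_nonneg_ae hnonneg
    (L2.integrable_inner (𝕜 := ℝ) (α • g - Q g) g)).1
      (le_antisymm hle (integral_nonneg_of_ae hnonneg))
  filter_upwards [key, hzero] with x hx hx0
  by_contra hlt
  exact (hx.2 (not_le.1 hlt)).ne' hx0
end
end

section
/- Let (X, 𝓕, μ) be a probability space, let X × ℤ₂ carry the measure μ⊗ν with ν the uniform probability measure on ℤ₂, and let S(x,y) = (x, y + 1 mod 2) with Koopman operator Ŝ. Let Q₀ be a bounded positivity-preserving operator on L²(μ) and let Q = Q₀ ⊗ E be the induced operator on L²(μ⊗ν) acting as Q₀ in the first variable. Suppose α ≥ 0 and there is a positivity-preserving bounded operator P on L²(μ⊗ν) with α·E + P = (1/2)·Q + (1/2)·Q∘Ŝ. Then Q₀ = 2α·E + Q₀' for some positivity-preserving bounded operator Q₀' on L²(μ); i.e. ⟨Q₀ g, g⟩ ≥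 2α⟨g, g⟩ for all g ≥ 0 and Q₀g ≥ 2αg a.e. for all g ≥ 0. -/
open MeasureTheory Filter Topology
open scoped ENNReal InnerProductSpace

noncomputable section

/-- `ℤ₂ = ℤ/2ℤ` as a discrete measurable space. -/
instance : MeasurableSpace (ZMod 2) := ⊤

/-- If every point of `Y` has positive mass, then a property holds almost everywhere for a product
measure on `X × Y` iff it holds on the whole fiber over almost every point of `X`. -/
theorem ae_prod_iff_ae_forall_fiber {X Y : Type*} [MeasurableSpace X] [MeasurableSpace Y]
    {μ : Measure X} {ν : Measure Y} [SFinite ν] (hν : ∀ y, ν {y} ≠ 0) {p : X × Y → Prop} :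
    (∀ᵐ z ∂μ.prod ν, p z) ↔ ∀ᵐ x ∂μ, ∀ y, p (x, y) := by
  constructor
  · intro h
    filter_upwards [Measure.ae_ae_of_ae_prod h] with x hx y
    by_contra hy
    exact hν y (measure_mono_null (Set.singleton_subset_iff.2 hy) (ae_iff.1 hx))
  · intro h
    filter_upwards [Measure.quasiMeasurePreserving_fst.ae h] with z hz using hz z.2

/-- The `L²` inner product of two almost everywhere nonnegative functions is nonnegative. -/
theorem L2_inner_nonneg_of_ae_nonneg {X : Type*} [MeasurableSpace X] {μ : Measure X}
    {f g : Lp ℝ 2 μ} (hf : 0 ≤ᵐ[μ] ⇑f) (hg : 0 ≤ᵐ[μ] ⇑g) : 0 ≤ ⟪f, g⟫_ℝ := by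
  rw [L2.inner_def]
  refine integral_nonneg_of_ae ?_
  filter_upwards [hf, hg] with x hfx hgx
  simpa using mul_nonneg hgx hfx

/-- If `Q = Q₀ ⊗ E` (acting as the positivity-preserving `Q₀` in the first variable on
`L²(μ ⊗ ν)`, `ν` uniform on `ℤ₂`) and `α·E + P = (1/2)Q + (1/2)Q∘Ŝ` for some
positivity-preserving `P`, then `Q₀ = 2α·E + Q₀'` for a positivity-preserving `Q₀'`; i.e.
`⟨Q₀ g, g⟩ ≥ 2α⟨g, g⟩` and `Q₀ g ≥ 2α·g` a.e. for every `g ≥ 0`. -/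
theorem tensor_decomposition_pos {X : Type*} [MeasurableSpace X]
    (μ : Measure X) [IsProbabilityMeasure μ]
    (ν : Measure (ZMod 2)) [IsProbabilityMeasure ν] (hν : ∀ y : ZMod 2, ν {y} = 1 / 2)
    -- `Shat` is the Koopman operator of `S(x,y) = (x, y+1)`
    (Shat : Lp ℝ 2 (μ.prod ν) →L[ℝ] Lp ℝ 2 (μ.prod ν))
    (hShat : ∀ f : Lp ℝ 2 (μ.prod ν),
      (Shat f : X × ZMod 2 → ℝ) =ᵐ[μ.prod ν] fun p => f (p.1, p.2 + 1))
    -- `Q₀` is a positivity-preserving bounded operator on `L²(μ)`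
    (Q₀ : Lp ℝ 2 μ →L[ℝ] Lp ℝ 2 μ)
    (hQ₀pos : ∀ g : Lp ℝ 2 μ, 0 ≤ᵐ[μ] ⇑g → 0 ≤ᵐ[μ] ⇑(Q₀ g))
    -- `tensor g h` is the function `(x,y) ↦ g x * h y` of `L²(μ ⊗ ν)`
    (tensor : Lp ℝ 2 μ → Lp ℝ 2 ν → Lp ℝ 2 (μ.prod ν))
    (htensor : ∀ (g : Lp ℝ 2 μ) (h : Lp ℝ 2 ν),
      (tensor g h : X × ZMod 2 → ℝ) =ᵐ[μ.prod ν] fun p => g p.1 * h p.2)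
    -- `Q = Q₀ ⊗ E` acts as `Q₀` in the first variable
    (Q : Lp ℝ 2 (μ.prod ν) →L[ℝ] Lp ℝ 2 (μ.prod ν))
    (hQ : ∀ (g : Lp ℝ 2 μ) (h : Lp ℝ 2 ν), Q (tensor g h) = tensor (Q₀ g) h)
    (α : ℝ) (hα : 0 ≤ α)
    (P : Lp ℝ 2 (μ.prod ν) →L[ℝ] Lp ℝ 2 (μ.prod ν))
    (hPpos : ∀ f : Lp ℝ 2 (μ.prod ν), 0 ≤ᵐ[μ.prod ν] ⇑f → 0 ≤ᵐ[μ.prod ν] ⇑(P f))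
    (hP : α • (1 : Lp ℝ 2 (μ.prod ν) →L[ℝ] Lp ℝ 2 (μ.prod ν)) + P =
      (2⁻¹ : ℝ) • Q + (2⁻¹ : ℝ) • (Q.comp Shat)) :
    (∀ g : Lp ℝ 2 μ, 0 ≤ᵐ[μ] ⇑g → 2 * α * ⟪g, g⟫_ℝ ≤ ⟪Q₀ g, g⟫_ℝ) ∧
    (∀ g : Lp ℝ 2 μ, 0 ≤ᵐ[μ] ⇑g → (fun x => 2 * α * g x) ≤ᵐ[μ] ⇑(Q₀ g)) ∧
    ∃ Q₀' : Lp ℝ 2 μ →L[ℝ] Lp ℝ 2 μ,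
      (∀ g : Lp ℝ 2 μ, 0 ≤ᵐ[μ] ⇑g → 0 ≤ᵐ[μ] ⇑(Q₀' g)) ∧
      Q₀ = (2 * α) • (1 : Lp ℝ 2 μ →L[ℝ] Lp ℝ 2 μ) + Q₀' := by
  have hν0 : ∀ y : ZMod 2, ν {y} ≠ 0 := fun y => by simp [hν y]
  have ind : ∀ y₀ : ZMod 2, ∃ h : Lp ℝ 2 ν, ∀ y, h y = if y = y₀ then 1 else 0 := by
    intro y₀
    have hs : MeasurableSet ({y₀} : Set (ZMod 2)) := trivial
    refine ⟨indicatorConstLp 2 hs (measure_ne_top ν _) 1, fun y => ?_⟩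
    have hae : ∀ᵐ y ∂ν, indicatorConstLp 2 hs (measure_ne_top ν _) (1 : ℝ) y =
        ({y₀} : Set (ZMod 2)).indicator (fun _ => (1 : ℝ)) y := indicatorConstLp_coeFn
    by_contra hy
    refine hν0 y (measure_mono_null (Set.singleton_subset_iff.2 ?_) (ae_iff.1 hae))
    simpa [Set.indicator_apply] using hy
  obtain ⟨h, hh⟩ := ind 0
  obtain ⟨h', hh'⟩ := ind 1
  have tensor_fiber : ∀ (g : Lp ℝ 2 μ) (k : Lp ℝ 2 ν),
      ∀ᵐ x ∂μ, ∀ y, tensor g k (x, y) = g x * k y := fun g k =>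
    (ae_prod_iff_ae_forall_fiber hν0).1 (htensor g k)
  have Shat_tensor : ∀ g : Lp ℝ 2 μ, Shat (tensor g h) = tensor g h' := by
    intro g
    refine Lp.ext ((ae_prod_iff_ae_forall_fiber hν0).2 ?_)
    filter_upwards [(ae_prod_iff_ae_forall_fiber hν0).1 (hShat (tensor g h)),
      tensor_fiber g h, tensor_fiber g h'] with x hx₁ hx₂ hx₃ y
    have hy : y + 1 = 0 ↔ y = 1 := by revert y; decide
    rw [hx₁ y, hx₂, hx₃, hh, hh']
    simp only [hy]
  have lower_bound : ∀ g : Lp ℝ 2 μ, 0 ≤ᵐ[μ] ⇑g → (fun x => 2 * α * g x) ≤ᵐ[μ] ⇑(Q₀ g) := by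
    intro g hg
    have tensor_nonneg : 0 ≤ᵐ[μ.prod ν] ⇑(tensor g h) := by
      refine (ae_prod_iff_ae_forall_fiber hν0).2 ?_
      filter_upwards [hg, tensor_fiber g h] with x hx hx' y
      rw [hx' y, hh]
      exact mul_nonneg hx (by split_ifs <;> norm_num)
    have key : α • tensor g h + P (tensor g h) =
        (2⁻¹ : ℝ) • tensor (Q₀ g) h + (2⁻¹ : ℝ) • tensor (Q₀ g) h' := by
      simpa [Shat_tensor, hQ] using congrArg (fun T => T (tensor g h)) hP
    have key_ae : ∀ᵐ p ∂μ.prod ν, α * tensor g h p + P (tensor g h) p =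
        2⁻¹ * tensor (Q₀ g) h p + 2⁻¹ * tensor (Q₀ g) h' p := by
      have e := Lp.coeFn_add (α • tensor g h) (P (tensor g h))
      rw [key] at e
      filter_upwards [e, Lp.coeFn_add ((2⁻¹ : ℝ) • tensor (Q₀ g) h) ((2⁻¹ : ℝ) • tensor (Q₀ g) h'),
        Lp.coeFn_smul α (tensor g h), Lp.coeFn_smul (2⁻¹ : ℝ) (tensor (Q₀ g) h),
        Lp.coeFn_smul (2⁻¹ : ℝ) (tensor (Q₀ g) h')] with p h₁ h₂ h₃ h₄ h₅
      simp only [Pi.add_apply, Pi.smul_apply, smul_eq_mul] at h₁ h₂ h₃ h₄ h₅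
      linarith
    filter_upwards [(ae_prod_iff_ae_forall_fiber hν0).1 key_ae,
      (ae_prod_iff_ae_forall_fiber hν0).1 (hPpos _ tensor_nonneg),
      tensor_fiber g h, tensor_fiber (Q₀ g) h, tensor_fiber (Q₀ g) h'] with x hx hPx h₁ h₂ h₃
    have hx0 := hx 0
    have hPx0 : 0 ≤ P (tensor g h) (x, 0) := hPx 0
    rw [h₁, h₂, h₃, hh, hh'] at hx0
    simp only [if_true, zero_ne_one, if_false] at hx0
    linarith
  have remainder_nonneg : ∀ g : Lp ℝ 2 μ, 0 ≤ᵐ[μ] ⇑g →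
      0 ≤ᵐ[μ] ⇑((Q₀ - (2 * α) • (1 : Lp ℝ 2 μ →L[ℝ] Lp ℝ 2 μ)) g) := by
    intro g hg
    have e : (Q₀ - (2 * α) • (1 : Lp ℝ 2 μ →L[ℝ] Lp ℝ 2 μ)) g = Q₀ g - (2 * α) • g := rfl
    rw [e]
    filter_upwards [lower_bound g hg, Lp.coeFn_sub (Q₀ g) ((2 * α) • g),
      Lp.coeFn_smul (2 * α) g] with x h₁ h₂ h₃
    rw [h₂, Pi.sub_apply, h₃]
    simpa using h₁
  refine ⟨fun g hg => ?_, lower_bound, _, remainder_nonneg, by abel⟩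
  have hinner := L2_inner_nonneg_of_ae_nonneg (remainder_nonneg g hg) hg
  have e : (Q₀ - (2 * α) • (1 : Lp ℝ 2 μ →L[ℝ] Lp ℝ 2 μ)) g = Q₀ g - (2 * α) • g := rfl
  rw [e, inner_sub_left, real_inner_smul_left] at hinner
  linarith
end
end

section
/- Let T be an invertible measure-preserving transformation of a probability space (X, 𝓕, μ) which is α-rigid with α > 1/2. Then T has no mixing component: there is no nonzero closed T̂-invariant subspace H of L²(μ) such that ⟨T̂^k f, g⟩ → 0 as k → ∞ for all f, g ∈ H. -/
open MeasureTheory Filter Topology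
open scoped ENNReal InnerProductSpace

noncomputable section

/-- `H` is a mixing component of `T`: a nonzero closed subspace of `L²`, invariant under the
Koopman operator of `T`, on which the matrix coefficients of the powers of the Koopman
operator tend to `0`. -/
def IsMixingComponent {X : Type*} [MeasurableSpace X] {μ : Measure X} {T : X → X}
    (hT : MeasurePreserving T μ μ) (H : Submodule ℝ (Lp ℝ 2 μ)) : Prop :=
  H ≠ ⊥ ∧ IsClosed (H : Set (Lp ℝ 2 μ)) ∧ (∀ f ∈ H, koopman hT f ∈ H) ∧
    ∀ f ∈ H, ∀ g ∈ H, Tendsto (fun k : ℕ => ⟪(koopman hT ^ k) f, g⟫_ℝ) atTop (nhds 0)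

theorem koopman_pow_coeFn {X : Type*} [MeasurableSpace X] {μ : Measure X} {T : X → X}
    (hT : MeasurePreserving T μ μ) (k : ℕ) (f : Lp ℝ 2 μ) :
    ((koopman hT ^ k) f : X → ℝ) =ᵐ[μ] fun x => f (T^[k] x) := by
  induction k with
  | zero => simp
  | succ n ih =>
    rw [pow_succ', mul_apply_eq_comp]
    have h1 : (koopman hT ((koopman hT ^ n) f) : X → ℝ) =ᵐ[μ] (koopman hT ^ n) f ∘ T :=
      Lp.coeFn_compMeasurePreserving _ hT
    have h2 := hT.quasiMeasurePreserving.tendsto_ae.eventually ih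
    filter_upwards [h1, h2] with x hx hx'
    rw [hx, Function.comp_apply, hx', Function.iterate_succ_apply]

theorem norm_koopman_pow {X : Type*} [MeasurableSpace X] {μ : Measure X} {T : X → X}
    (hT : MeasurePreserving T μ μ) (k : ℕ) (f : Lp ℝ 2 μ) : ‖(koopman hT ^ k) f‖ = ‖f‖ := by
  induction k with
  | zero => simp
  | succ n ih =>
    rw [pow_succ', mul_apply_eq_comp, ← ih]
    exact (Lp.compMeasurePreservingₗᵢ ℝ T hT).norm_map _

theorem Lp_two_norm_sq {X : Type*} [MeasurableSpace X] {μ : Measure X} (f : Lp ℝ 2 μ) :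
    ‖f‖ ^ 2 = ∫ x, f x ^ 2 ∂μ := by
  rw [← real_inner_self_eq_norm_sq, L2.inner_def]
  simp [sq]

theorem measureReal_image_iterate_inter {X : Type*} [MeasurableSpace X] {μ : Measure X}
    (T : X ≃ᵐ X) (hT : MeasurePreserving T μ μ) (k : ℕ) {A : Set X} (hA : MeasurableSet A) :
    (μ ((⇑T)^[k] '' A ∩ A)).toReal = μ.real (A ∩ (⇑T)^[k] ⁻¹' A) := by
  have hinj : Function.Injective (⇑T)^[k] := T.injective.iterate k
  have hm : MeasurableSet ((⇑T)^[k] '' A) := by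
    induction k with
    | zero => simpa
    | succ n ih =>
      rw [Function.iterate_succ', Set.image_comp]
      exact T.measurableSet_image.2 (ih (T.injective.iterate n))
  rw [← (hT.iterate k).measure_preimage (hm.inter hA).nullMeasurableSet, Set.preimage_inter,
    hinj.preimage_image, measureReal_def]

/-- The square norm of a simple function as a sum over its level sets. -/
theorem integral_simpleFunc_sq {X : Type*} [MeasurableSpace X] {μ : Measure X}
    [IsFiniteMeasure μ] (s : SimpleFunc X ℝ) :
    ∫ x, s x ^ 2 ∂μ = ∑ c ∈ s.range, c ^ 2 * μ.real (s ⁻¹' {c}) := by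
  have h : ∀ x, s x ^ 2 = ∑ c ∈ s.range, (s ⁻¹' {c}).indicator (fun _ => c ^ 2) x := by
    intro x
    rw [Finset.sum_eq_single (s x)]
    · simp
    · intro c _ hc
      exact Set.indicator_of_notMem (fun h => hc (by simpa using h.symm)) _
    · exact fun h => absurd (s.mem_range_self x) h
  simp_rw [h]
  rw [integral_finsetSum]
  · refine Finset.sum_congr rfl fun c _ => ?_
    rw [integral_indicator_const _ (s.measurableSet_fiber c), smul_eq_mul, mul_comm]
  · exact fun c _ => (integrable_const _).indicator (s.measurableSet_fiber c)

theorem sum_le_integral_simpleFunc_add_comp_sq {X : Type*} [MeasurableSpace X] {μ : Measure X}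
    [IsFiniteMeasure μ] (s : SimpleFunc X ℝ) {F : X → X} (hF : Measurable F) :
    4 * ∑ c ∈ s.range, c ^ 2 * μ.real (s ⁻¹' {c} ∩ F ⁻¹' (s ⁻¹' {c})) ≤
      ∫ x, (s x + s (F x)) ^ 2 ∂μ := by
  have hm : ∀ c, MeasurableSet (s ⁻¹' {c} ∩ F ⁻¹' (s ⁻¹' {c})) := fun c =>
    (s.measurableSet_fiber c).inter (hF (s.measurableSet_fiber c))
  have hi : ∀ c ∈ s.range, Integrable
      ((s ⁻¹' {c} ∩ F ⁻¹' (s ⁻¹' {c})).indicator fun _ => 4 * c ^ 2) μ :=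
    fun c _ => (integrable_const _).indicator (hm c)
  calc 4 * ∑ c ∈ s.range, c ^ 2 * μ.real (s ⁻¹' {c} ∩ F ⁻¹' (s ⁻¹' {c}))
      = ∫ x, ∑ c ∈ s.range,
          (s ⁻¹' {c} ∩ F ⁻¹' (s ⁻¹' {c})).indicator (fun _ => 4 * c ^ 2) x ∂μ := by
        rw [integral_finsetSum _ hi, Finset.mul_sum]
        refine Finset.sum_congr rfl fun c _ => ?_
        rw [integral_indicator_const _ (hm c), smul_eq_mul]
        ring
    _ ≤ _ := by
        refine integral_mono (integrable_finsetSum _ hi) ?_ fun x => ?_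
        · let t : SimpleFunc X ℝ := (s + s.comp F hF) * (s + s.comp F hF)
          have ht : Integrable t μ := t.integrable_of_isFiniteMeasure
          refine ht.congr (Eventually.of_forall fun x => ?_)
          simp [t, sq]
        · dsimp only
          rw [Finset.sum_eq_single (s x)]
          · by_cases h : s (F x) = s x
            · rw [Set.indicator_of_mem (by simp [h]), h]
              exact le_of_eq (by ring)
            · rw [Set.indicator_of_notMem (by simp [h])]
              positivity
          · intro c _ hc
            exact Set.indicator_of_notMem (fun h => hc (by simpa using h.1.symm)) _
          · exact fun h => absurd (s.mem_range_self x) h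

/-- Along an `α`-rigidity sequence, `‖g + U^k g‖ ^ 2` is asymptotically at least `4 α ‖g‖ ^ 2`
for simple functions `g`. -/
theorem IsRigidSeqOn.eventually_le_norm_add_sq {X : Type*} [MeasurableSpace X] {μ : Measure X}
    [IsFiniteMeasure μ] {T : X ≃ᵐ X} (hT : MeasurePreserving T μ μ) {α : ℝ} {k : ℕ → ℕ}
    (hk : IsRigidSeqOn μ T α k) (g : Lp.simpleFunc ℝ 2 μ) {ε : ℝ} (hε : 0 < ε) :
    ∀ᶠ i in atTop, 4 * α * ‖(g : Lp ℝ 2 μ)‖ ^ 2 - ε ≤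
      ‖(g : Lp ℝ 2 μ) + (koopman hT ^ k i) g‖ ^ 2 := by
  set s := Lp.simpleFunc.toSimpleFunc g with hs
  have hsg : s =ᵐ[μ] (g : Lp ℝ 2 μ) := Lp.simpleFunc.toSimpleFunc_eq_toFun g
  have hnorm : ‖(g : Lp ℝ 2 μ)‖ ^ 2 = ∑ c ∈ s.range, c ^ 2 * μ.real (s ⁻¹' {c}) := by
    rw [Lp_two_norm_sq, ← integral_simpleFunc_sq]
    refine integral_congr_ae ?_
    filter_upwards [hsg] with x hx
    rw [hx]
  have hadd : ∀ n, ‖(g : Lp ℝ 2 μ) + (koopman hT ^ n) g‖ ^ 2 =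
      ∫ x, (s x + s ((⇑T)^[n] x)) ^ 2 ∂μ := by
    intro n
    rw [Lp_two_norm_sq]
    refine integral_congr_ae ?_
    filter_upwards [hsg, Lp.coeFn_add (g : Lp ℝ 2 μ) ((koopman hT ^ n) g),
      koopman_pow_coeFn hT n (g : Lp ℝ 2 μ),
      (hT.iterate n).quasiMeasurePreserving.tendsto_ae.eventually hsg] with x h1 h2 h3 h4
    rw [h2, Pi.add_apply, h3, h1, h4]
  set C := 4 * ∑ c ∈ s.range, c ^ 2 with hC
  have hC0 : 0 ≤ C := by positivity
  obtain ⟨η, hη, hηC⟩ : ∃ η : ℝ, 0 < η ∧ C * η ≤ ε := by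
    refine ⟨ε / (C + 1), by positivity, ?_⟩
    rw [mul_div_assoc', div_le_iff₀ (by positivity)]
    nlinarith
  have hev : ∀ c ∈ s.range, ∀ᶠ i in atTop, α * μ.real (s ⁻¹' {c}) - η <
      μ.real (s ⁻¹' {c} ∩ (⇑T)^[k i] ⁻¹' (s ⁻¹' {c})) := by
    intro c _
    have h := hk _ (s.measurableSet_fiber c)
    simp_rw [measureReal_image_iterate_inter T hT _ (s.measurableSet_fiber c)] at h
    exact eventually_lt_of_lt_liminf ((sub_lt_self _ hη).trans_le h)
      (isBoundedUnder_of ⟨0, fun _ => measureReal_nonneg⟩)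
  filter_upwards [(Finset.eventually_all s.range).2 hev] with i hi
  rw [hadd]
  refine le_trans ?_ (sum_le_integral_simpleFunc_add_comp_sq s (hT.iterate (k i)).measurable)
  have hsum : ∑ c ∈ s.range, c ^ 2 * (α * μ.real (s ⁻¹' {c}) - η) ≤
      ∑ c ∈ s.range, c ^ 2 * μ.real (s ⁻¹' {c} ∩ (⇑T)^[k i] ⁻¹' (s ⁻¹' {c})) :=
    Finset.sum_le_sum fun c hc => mul_le_mul_of_nonneg_left (hi c hc).le (sq_nonneg c)
  have heq : ∑ c ∈ s.range, c ^ 2 * (α * μ.real (s ⁻¹' {c}) - η) =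
      α * ‖(g : Lp ℝ 2 μ)‖ ^ 2 - (∑ c ∈ s.range, c ^ 2) * η := by
    rw [hnorm, Finset.mul_sum, Finset.sum_mul, ← Finset.sum_sub_distrib]
    exact Finset.sum_congr rfl fun c _ => by ring
  rw [heq] at hsum
  rw [hC] at hηC
  linarith

/-- An `α`-rigid transformation with `α > 1/2` has no mixing component in its spectrum. -/
theorem no_mixing_component_of_alphaRigid {X : Type*} [MeasurableSpace X]
    (μ : Measure X) [IsProbabilityMeasure μ]
    (T : X ≃ᵐ X) (hT : MeasurePreserving T μ μ)
    (α : ℝ) (hα : 1 / 2 < α) (hrig : IsAlphaRigid μ T α) :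
    ¬ ∃ H : Submodule ℝ (Lp ℝ 2 μ), IsMixingComponent hT H := by
  rintro ⟨H, hne, -, -, hmix⟩
  obtain ⟨-, k, -, hk, hrigid⟩ := hrig.1
  obtain ⟨f, hfH, hf⟩ := H.ne_bot_iff.1 hne
  have hlim : Tendsto (fun i => ‖f + (koopman hT ^ k i) f‖ ^ 2) atTop (𝓝 (2 * ‖f‖ ^ 2)) := by
    have h := (((hmix f hfH f hfH).comp hk).const_mul 2).const_add (2 * ‖f‖ ^ 2)
    simp only [mul_zero, add_zero] at h
    refine h.congr fun i => ?_
    rw [norm_add_sq_real, norm_koopman_pow, Function.comp_apply, real_inner_comm]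
    ring
  have key : ∀ g : Lp.simpleFunc ℝ 2 μ,
      4 * α * ‖(g : Lp ℝ 2 μ)‖ ^ 2 ≤ (√(2 * ‖f‖ ^ 2) + 2 * ‖(g : Lp ℝ 2 μ) - f‖) ^ 2 := by
    intro g
    refine le_of_forall_pos_le_add fun ε hε => ?_
    have hsqrt : Tendsto (fun i => (‖f + (koopman hT ^ k i) f‖ + 2 * ‖(g : Lp ℝ 2 μ) - f‖) ^ 2)
        atTop (𝓝 ((√(2 * ‖f‖ ^ 2) + 2 * ‖(g : Lp ℝ 2 μ) - f‖) ^ 2)) := by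
      refine (Tendsto.add_const _ ?_).pow 2
      simpa using hlim.sqrt
    refine ge_of_tendsto (hsqrt.add_const ε) ?_
    filter_upwards [hrigid.eventually_le_norm_add_sq hT g hε] with i hi
    have htri : ‖(g : Lp ℝ 2 μ) + (koopman hT ^ k i) g‖ ≤
        ‖f + (koopman hT ^ k i) f‖ + 2 * ‖(g : Lp ℝ 2 μ) - f‖ := by
      have hsplit : (g : Lp ℝ 2 μ) + (koopman hT ^ k i) g = (f + (koopman hT ^ k i) f) +
          (((g : Lp ℝ 2 μ) - f) + (koopman hT ^ k i) ((g : Lp ℝ 2 μ) - f)) := by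
        rw [map_sub]
        abel
      rw [hsplit]
      refine (norm_add_le _ _).trans (add_le_add_right ((norm_add_le _ _).trans ?_) _)
      rw [norm_koopman_pow, two_mul]
    have := pow_le_pow_left₀ (norm_nonneg _) htri 2
    linarith
  have hf_le : 4 * α * ‖f‖ ^ 2 ≤ (√(2 * ‖f‖ ^ 2) + 2 * ‖f - f‖) ^ 2 := by
    refine (Lp.simpleFunc.dense (E := ℝ) (μ := μ) (p := 2) (by simp)).induction
      (P := fun g => 4 * α * ‖g‖ ^ 2 ≤ (√(2 * ‖f‖ ^ 2) + 2 * ‖g - f‖) ^ 2)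
      (fun g hg => key ⟨g, hg⟩) (isClosed_le (by fun_prop) (by fun_prop)) f
  rw [sub_self, norm_zero, mul_zero, add_zero, Real.sq_sqrt (by positivity)] at hf_le
  have : 0 < ‖f‖ ^ 2 := pow_pos (norm_pos_iff.2 hf) 2
  nlinarith
end
end
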